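/- arXiv:2101.04863 — 8 statements merged into one kernel-verified Lean document; each statement's English description precedes it below -/
import Mathlib

section
/- Let V₁, V₂ be subspaces of V that are mutually orthogonal, i.e. (v₁, v₂) = 0 for all v₁ ∈ V₁ and v₂ ∈ V₂. Let τ > 0 and let u₁ⁿ ∈ V₁, u₂ⁿ ∈ V₂ (n = 0, 1, …, N) satisfy the partially explicit scheme: ((u₁ⁿ⁺¹ − u₁ⁿ)/τ, v₁) + a(u₁ⁿ⁺¹ + u₂ⁿ, v₁) = 0 for all v₁ ∈ V₁, and ((u₂ⁿ⁺¹ − u₂ⁿ)/τ, v₂) + a(u₁ⁿ⁺¹ + u₂ⁿ, v₂) = 0 for all v₂ ∈ V₂, for n = 0, …, N−1. If 2‖v₂‖² ≥ τ‖v₂‖_a² for every v₂ ∈ V₂, then the scheme is stable in the sense that ‖uⁿ‖_a ≤ ‖u⁰‖_a for all n = 1, …, N, where uⁿ := u₁ⁿ + u₂ⁿ. -/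
open scoped RealInnerProductSpace

/-- Energy decay over one step: `w` is the intermediate state, reached from `w - d₁` by the implicit
increment `d₁` and left towards `w + d₂` by the explicit increment `d₂`. -/
theorem energy_step_le {V : Type*} [NormedAddCommGroup V] [InnerProductSpace ℝ V]
    {a : V →ₗ[ℝ] V →ₗ[ℝ] ℝ} (ha_symm : ∀ u v : V, a u v = a v u) (ha_pos : ∀ v : V, 0 ≤ a v v)
    {τ : ℝ} (hτ : 0 < τ) {w d₁ d₂ : V}
    (h₁ : ⟪τ⁻¹ • d₁, d₁⟫ + a w d₁ = 0) (h₂ : ⟪τ⁻¹ • d₂, d₂⟫ + a w d₂ = 0)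
    (hstab : τ * a d₂ d₂ ≤ 2 * ‖d₂‖ ^ 2) :
    a (w + d₂) (w + d₂) ≤ a (w - d₁) (w - d₁) := by
  rw [real_inner_smul_left, real_inner_self_eq_norm_sq] at h₁ h₂
  have hd₁ : 0 ≤ τ⁻¹ * ‖d₁‖ ^ 2 := by positivity
  have hd₂ : a d₂ d₂ ≤ 2 * (τ⁻¹ * ‖d₂‖ ^ 2) := by
    calc a d₂ d₂ = τ⁻¹ * (τ * a d₂ d₂) := by field_simp
      _ ≤ τ⁻¹ * (2 * ‖d₂‖ ^ 2) := by gcongr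
      _ = 2 * (τ⁻¹ * ‖d₂‖ ^ 2) := by ring
  simp only [map_add, map_sub, LinearMap.add_apply, LinearMap.sub_apply, ha_symm d₁ w,
    ha_symm d₂ w]
  linarith [ha_pos d₁]

/-- Stability of the partially explicit scheme (3.2) with mutually orthogonal
subspaces `V₁`, `V₂`: if `2‖v₂‖² ≥ τ‖v₂‖_a²` for every `v₂ ∈ V₂`, then
`‖uⁿ‖_a ≤ ‖u⁰‖_a` for `n = 1, …, N`, where `uⁿ = u₁ⁿ + u₂ⁿ`. -/
theorem partially_explicit_orthogonal_stability
    {V : Type*} [NormedAddCommGroup V] [InnerProductSpace ℝ V] [FiniteDimensional ℝ V]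
    (a : V →ₗ[ℝ] V →ₗ[ℝ] ℝ)
    (ha_symm : ∀ u v : V, a u v = a v u)
    (ha_pos : ∀ v : V, 0 ≤ a v v)
    (V₁ V₂ : Submodule ℝ V)
    (horth : ∀ v₁ ∈ V₁, ∀ v₂ ∈ V₂, ⟪v₁, v₂⟫ = 0)
    (τ : ℝ) (hτ : 0 < τ) (N : ℕ)
    (u₁ u₂ : ℕ → V)
    (hu₁ : ∀ n, u₁ n ∈ V₁) (hu₂ : ∀ n, u₂ n ∈ V₂)
    (hscheme₁ : ∀ n < N, ∀ v₁ ∈ V₁,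
      ⟪τ⁻¹ • (u₁ (n + 1) - u₁ n), v₁⟫ + a (u₁ (n + 1) + u₂ n) v₁ = 0)
    (hscheme₂ : ∀ n < N, ∀ v₂ ∈ V₂,
      ⟪τ⁻¹ • (u₂ (n + 1) - u₂ n), v₂⟫ + a (u₁ (n + 1) + u₂ n) v₂ = 0)
    (hstab : ∀ v₂ ∈ V₂, τ * a v₂ v₂ ≤ 2 * ‖v₂‖ ^ 2) :
    ∀ n, 1 ≤ n → n ≤ N →
      Real.sqrt (a (u₁ n + u₂ n) (u₁ n + u₂ n)) ≤
        Real.sqrt (a (u₁ 0 + u₂ 0) (u₁ 0 + u₂ 0)) := by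
  intro n _ hn
  apply Real.sqrt_le_sqrt
  induction n with
  | zero => exact le_rfl
  | succ n ih =>
    have hd₁ := V₁.sub_mem (hu₁ (n + 1)) (hu₁ n)
    have hd₂ := V₂.sub_mem (hu₂ (n + 1)) (hu₂ n)
    have hstep := energy_step_le ha_symm ha_pos hτ (hscheme₁ n hn _ hd₁) (hscheme₂ n hn _ hd₂)
      (hstab _ hd₂)
    rw [show u₁ (n + 1) + u₂ n + (u₂ (n + 1) - u₂ n) = u₁ (n + 1) + u₂ (n + 1) by abel,
      show u₁ (n + 1) + u₂ n - (u₁ (n + 1) - u₁ n) = u₁ n + u₂ n by abel] at hstep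
    rcases Nat.eq_zero_or_pos n with rfl | hpos
    · exact hstep
    · exact hstep.trans (ih hpos (by omega))
end

section
/- Assume the partially explicit scheme with μ = 0: for n = 1, …, N−1, (u₁ⁿ⁺¹ − u₁ⁿ + u₂ⁿ − u₂ⁿ⁻¹, v) = −τ a(u₁ⁿ⁺¹ + u₂ⁿ, v) for all v ∈ V₁, and (u₂ⁿ⁺¹ − u₂ⁿ + u₁ⁿ − u₁ⁿ⁻¹, v) = −τ a((1−ω)u₁ⁿ + ω u₁ⁿ⁺¹ + u₂ⁿ, v) for all v ∈ V₂. If τ‖v‖_a² ≤ ((1−γ²)/(2−ω))‖v‖² for all v ∈ V₂, then for every n ≥ 1, (γ²/2)(‖u₁ⁿ⁺¹ − u₁ⁿ‖² + ‖u₂ⁿ⁺¹ − u₂ⁿ‖²) + (τ/2)‖uⁿ⁺¹‖_a² ≤ (γ²/2)(‖u₁ⁿ − u₁ⁿ⁻¹‖² + ‖u₂ⁿ − u₂ⁿ⁻¹‖²) + (τ/2)‖uⁿ‖_a², where uⁿ := u₁ⁿ + u₂ⁿ. -/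
open scoped RealInnerProductSpace

/-- Theorem 3.2: stability of the partially explicit scheme (3.7)–(3.8) with `μ = 0`.
If `τ‖v‖_a² ≤ ((1−γ²)/(2−ω))‖v‖²` for all `v ∈ V₂`, then the discrete energy
`(γ²/2)∑ᵢ‖uᵢⁿ⁺¹ − uᵢⁿ‖² + (τ/2)‖uⁿ⁺¹‖_a²` is nonincreasing for `n ≥ 1`. -/
theorem partially_explicit_stability
    {V : Type*} [NormedAddCommGroup V] [InnerProductSpace ℝ V] [FiniteDimensional ℝ V]
    (a : V →ₗ[ℝ] V →ₗ[ℝ] ℝ)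
    (ha_symm : ∀ u v : V, a u v = a v u)
    (ha_pos : ∀ v : V, 0 ≤ a v v)
    (V₁ V₂ : Submodule ℝ V) (hV : V₁ ⊓ V₂ = ⊥)
    (γ : ℝ) (hγ0 : 0 ≤ γ) (hγ1 : γ < 1)
    (hCS : ∀ v₁ ∈ V₁, ∀ v₂ ∈ V₂, ⟪v₁, v₂⟫ ≤ γ * ‖v₁‖ * ‖v₂‖)
    (τ : ℝ) (hτ : 0 < τ)
    (ω : ℝ) (hω0 : 0 ≤ ω) (hω1 : ω ≤ 1) (N : ℕ)
    (u₁ u₂ : ℕ → V)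
    (hu₁ : ∀ n, u₁ n ∈ V₁) (hu₂ : ∀ n, u₂ n ∈ V₂)
    (hscheme₁ : ∀ n, 1 ≤ n → n < N → ∀ v ∈ V₁,
      ⟪u₁ (n + 1) - u₁ n + u₂ n - u₂ (n - 1), v⟫ = -τ * a (u₁ (n + 1) + u₂ n) v)
    (hscheme₂ : ∀ n, 1 ≤ n → n < N → ∀ v ∈ V₂,
      ⟪u₂ (n + 1) - u₂ n + u₁ n - u₁ (n - 1), v⟫ =
        -τ * a ((1 - ω) • u₁ n + ω • u₁ (n + 1) + u₂ n) v)
    (hstab : ∀ v ∈ V₂, τ * a v v ≤ ((1 - γ ^ 2) / (2 - ω)) * ‖v‖ ^ 2) :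
    ∀ n, 1 ≤ n → n < N →
      γ ^ 2 / 2 * (‖u₁ (n + 1) - u₁ n‖ ^ 2 + ‖u₂ (n + 1) - u₂ n‖ ^ 2) +
          τ / 2 * a (u₁ (n + 1) + u₂ (n + 1)) (u₁ (n + 1) + u₂ (n + 1)) ≤
        γ ^ 2 / 2 * (‖u₁ n - u₁ (n - 1)‖ ^ 2 + ‖u₂ n - u₂ (n - 1)‖ ^ 2) +
          τ / 2 * a (u₁ n + u₂ n) (u₁ n + u₂ n) := by
  intro n hn hnN
  obtain ⟨d₁, hd₁⟩ : ∃ d, d = u₁ (n + 1) - u₁ n := ⟨_, rfl⟩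
  obtain ⟨d₂, hd₂⟩ : ∃ d, d = u₂ (n + 1) - u₂ n := ⟨_, rfl⟩
  obtain ⟨p₁, hp₁⟩ : ∃ d, d = u₁ n - u₁ (n - 1) := ⟨_, rfl⟩
  obtain ⟨p₂, hp₂⟩ : ∃ d, d = u₂ n - u₂ (n - 1) := ⟨_, rfl⟩
  obtain ⟨u, hu⟩ : ∃ w, w = u₁ n + u₂ n := ⟨_, rfl⟩
  have hd₁V : d₁ ∈ V₁ := hd₁ ▸ V₁.sub_mem (hu₁ _) (hu₁ _)
  have hd₂V : d₂ ∈ V₂ := hd₂ ▸ V₂.sub_mem (hu₂ _) (hu₂ _)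
  have hp₁V : p₁ ∈ V₁ := hp₁ ▸ V₁.sub_mem (hu₁ _) (hu₁ _)
  have hp₂V : p₂ ∈ V₂ := hp₂ ▸ V₂.sub_mem (hu₂ _) (hu₂ _)
  have test₁ := hscheme₁ n hn hnN d₁ hd₁V
  have test₂ := hscheme₂ n hn hnN d₂ hd₂V
  rw [show u₁ (n + 1) - u₁ n + u₂ n - u₂ (n - 1) = d₁ + p₂ by rw [hd₁, hp₂]; abel,
    show u₁ (n + 1) + u₂ n = u + d₁ by rw [hd₁, hu]; abel,
    inner_add_left, real_inner_self_eq_norm_sq] at test₁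
  rw [show u₂ (n + 1) - u₂ n + u₁ n - u₁ (n - 1) = d₂ + p₁ by rw [hd₂, hp₁]; abel,
    show (1 - ω) • u₁ n + ω • u₁ (n + 1) + u₂ n = u + ω • d₁ by rw [hd₁, hu]; module,
    inner_add_left, real_inner_self_eq_norm_sq] at test₂
  rw [show u₁ (n + 1) + u₂ (n + 1) = u + d₁ + d₂ by rw [hd₁, hd₂, hu]; abel,
    ← hd₁, ← hd₂, ← hp₁, ← hp₂, ← hu]
  have cs₁ := hCS (-d₁) (V₁.neg_mem hd₁V) p₂ hp₂V
  have cs₂ := hCS p₁ hp₁V (-d₂) (V₂.neg_mem hd₂V)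
  rw [inner_neg_left, norm_neg, real_inner_comm] at cs₁
  rw [inner_neg_right, norm_neg] at cs₂
  have hdiff := ha_pos (d₁ - d₂)
  have hst := hstab d₂ hd₂V
  rw [div_mul_eq_mul_div, le_div_iff₀ (by linarith)] at hst
  simp only [map_add, map_sub, map_smul, LinearMap.add_apply, LinearMap.sub_apply,
    LinearMap.smul_apply, smul_eq_mul] at test₁ test₂ hdiff ⊢
  rw [ha_symm d₂ d₁] at hdiff ⊢
  rw [ha_symm d₁ u, ha_symm d₂ u]
  have hcross : 0 ≤ τ * (1 - ω) * (a d₁ d₁ - a d₁ d₂ - (a d₁ d₂ - a d₂ d₂)) :=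
    mul_nonneg (mul_nonneg hτ.le (by linarith)) hdiff
  have ha₁ : 0 ≤ τ * ω * a d₁ d₁ := mul_nonneg (mul_nonneg hτ.le hω0) (ha_pos d₁)
  have hγd₁ : 0 ≤ (1 - γ ^ 2) * ‖d₁‖ ^ 2 :=
    mul_nonneg (by nlinarith) (sq_nonneg _)
  linarith [sq_nonneg (‖d₁‖ - γ * ‖p₂‖), sq_nonneg (‖d₂‖ - γ * ‖p₁‖)]
end

section
/- Let S₁ and S₂ be finite-dimensional subspaces of a real inner product space with S₁ ∩ S₂ = {0}. Then there exists a constant β₀ with 0 ≤ β₀ < 1 such that (s₁, s₂) ≤ β₀‖s₁‖‖s₂‖ for all s₁ ∈ S₁ and s₂ ∈ S₂ (the strengthened Cauchy–Schwarz inequality). -/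
open scoped RealInnerProductSpace

/-- On the unit spheres of two finite-dimensional subspaces with trivial intersection, the inner
product is bounded by a constant strictly less than one. -/
theorem exists_inner_le_lt_one_of_norm_eq_one
    {V : Type*} [NormedAddCommGroup V] [InnerProductSpace ℝ V]
    (S₁ S₂ : Submodule ℝ V) [FiniteDimensional ℝ S₁] [FiniteDimensional ℝ S₂]
    (hdisj : S₁ ⊓ S₂ = ⊥) :
    ∃ β : ℝ, 0 ≤ β ∧ β < 1 ∧
      ∀ u ∈ S₁, ∀ v ∈ S₂, ‖u‖ = 1 → ‖v‖ = 1 → ⟪u, v⟫ ≤ β := by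
  have hK : IsCompact (Metric.sphere (0 : S₁) 1 ×ˢ Metric.sphere (0 : S₂) 1) :=
    (isCompact_sphere _ _).prod (isCompact_sphere _ _)
  rcases (Metric.sphere (0 : S₁) 1 ×ˢ Metric.sphere (0 : S₂) 1).eq_empty_or_nonempty with
    hempty | hne
  · refine ⟨0, le_rfl, one_pos, fun u hu v hv hu1 hv1 => ?_⟩
    have hmem : ((⟨u, hu⟩, ⟨v, hv⟩) : S₁ × S₂) ∈
        Metric.sphere (0 : S₁) 1 ×ˢ Metric.sphere (0 : S₂) 1 := by
      simp [hu1, hv1]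
    simp [hempty] at hmem
  · obtain ⟨⟨a, b⟩, hab, hmax⟩ := hK.exists_isMaxOn hne
      (f := fun p : S₁ × S₂ => ⟪(p.1 : V), (p.2 : V)⟫) (by fun_prop)
    have ha : ‖(a : V)‖ = 1 := by simpa using hab.1
    have hb : ‖(b : V)‖ = 1 := by simpa using hab.2
    have hne' : (a : V) ≠ b := by
      intro h
      have hmem : (a : V) ∈ S₁ ⊓ S₂ := ⟨a.2, h ▸ b.2⟩
      rw [hdisj, Submodule.mem_bot] at hmem
      simp [hmem] at ha
    refine ⟨max 0 ⟪(a : V), (b : V)⟫, le_max_left _ _,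
      max_lt one_pos ((inner_lt_one_iff_real_of_norm_eq_one ha hb).2 hne'),
      fun u hu v hv hu1 hv1 => le_max_of_le_right ?_⟩
    have hmem : ((⟨u, hu⟩, ⟨v, hv⟩) : S₁ × S₂) ∈
        Metric.sphere (0 : S₁) 1 ×ˢ Metric.sphere (0 : S₂) 1 := by
      simp [hu1, hv1]
    exact hmax hmem

/-- The strengthened Cauchy–Schwarz inequality: if `S₁` and `S₂` are
finite-dimensional subspaces of a real inner product space with `S₁ ∩ S₂ = {0}`,
then there is `0 ≤ β₀ < 1` with `(s₁, s₂) ≤ β₀‖s₁‖‖s₂‖` for all `s₁ ∈ S₁`, `s₂ ∈ S₂`. -/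
theorem strengthened_cauchy_schwarz
    {V : Type*} [NormedAddCommGroup V] [InnerProductSpace ℝ V]
    (S₁ S₂ : Submodule ℝ V)
    [FiniteDimensional ℝ S₁] [FiniteDimensional ℝ S₂]
    (hdisj : S₁ ⊓ S₂ = ⊥) :
    ∃ β₀ : ℝ, 0 ≤ β₀ ∧ β₀ < 1 ∧
      ∀ s₁ ∈ S₁, ∀ s₂ ∈ S₂, ⟪s₁, s₂⟫ ≤ β₀ * ‖s₁‖ * ‖s₂‖ := by
  obtain ⟨β, hβ0, hβ1, hβ⟩ := exists_inner_le_lt_one_of_norm_eq_one S₁ S₂ hdisj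
  refine ⟨β, hβ0, hβ1, fun s₁ h₁ s₂ h₂ => ?_⟩
  rcases eq_or_ne s₁ 0 with rfl | hs₁
  · simp
  rcases eq_or_ne s₂ 0 with rfl | hs₂
  · simp
  have hn₁ : 0 < ‖s₁‖ := norm_pos_iff.2 hs₁
  have hn₂ : 0 < ‖s₂‖ := norm_pos_iff.2 hs₂
  have key := hβ (‖s₁‖⁻¹ • s₁) (S₁.smul_mem _ h₁) (‖s₂‖⁻¹ • s₂) (S₂.smul_mem _ h₂)
    (norm_smul_inv_norm hs₁) (norm_smul_inv_norm hs₂)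
  rw [real_inner_smul_left, real_inner_smul_right] at key
  calc ⟪s₁, s₂⟫ = (‖s₁‖⁻¹ * (‖s₂‖⁻¹ * ⟪s₁, s₂⟫)) * (‖s₁‖ * ‖s₂‖) := by field_simp
    _ ≤ β * (‖s₁‖ * ‖s₂‖) := by gcongr
    _ = β * ‖s₁‖ * ‖s₂‖ := by ring
end

section
/- Let τ > 0 and let uⁿ ∈ V (n = 0, 1, …, N) satisfy the explicit (forward Euler) scheme ((uⁿ⁺¹ − uⁿ)/τ, v) + a(uⁿ, v) = 0 for all v ∈ V and n = 0, …, N−1. If 2‖v‖² ≥ τ‖v‖_a² for all v ∈ V, then ‖uⁿ‖_a ≤ ‖u⁰‖_a for all n = 1, …, N. -/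
open scoped RealInnerProductSpace

/-- One forward Euler step does not increase the energy `a u u`, provided `τ * a v v ≤ 2 * ‖v‖ ^ 2`
holds for the increment `v`. -/
theorem forward_euler_step_energy_le
    {V : Type*} [NormedAddCommGroup V] [InnerProductSpace ℝ V]
    (a : V →ₗ[ℝ] V →ₗ[ℝ] ℝ) (ha_symm : ∀ u v : V, a u v = a v u)
    {τ : ℝ} (hτ : 0 < τ) {u d : V}
    (hstep : ⟪τ⁻¹ • d, d⟫ + a u d = 0)
    (hstab : τ * a d d ≤ 2 * ‖d‖ ^ 2) :
    a (u + d) (u + d) ≤ a u u := by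
  rw [real_inner_smul_left, real_inner_self_eq_norm_sq] at hstep
  have hd : a d d ≤ 2 * (τ⁻¹ * ‖d‖ ^ 2) := by
    calc a d d = τ⁻¹ * (τ * a d d) := by rw [inv_mul_cancel_left₀ hτ.ne']
      _ ≤ τ⁻¹ * (2 * ‖d‖ ^ 2) := by gcongr
      _ = 2 * (τ⁻¹ * ‖d‖ ^ 2) := by ring
  simp only [map_add, LinearMap.add_apply, ha_symm d u]
  linarith

/-- Conditional stability of the explicit (forward Euler) scheme (2.9):
if `2‖v‖² ≥ τ‖v‖_a²` for all `v ∈ V`, then `‖uⁿ‖_a ≤ ‖u⁰‖_a` for `n = 1, …, N`. -/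
theorem forward_euler_stability
    {V : Type*} [NormedAddCommGroup V] [InnerProductSpace ℝ V] [FiniteDimensional ℝ V]
    (a : V →ₗ[ℝ] V →ₗ[ℝ] ℝ)
    (ha_symm : ∀ u v : V, a u v = a v u)
    (ha_pos : ∀ v : V, 0 ≤ a v v)
    (τ : ℝ) (hτ : 0 < τ) (N : ℕ)
    (u : ℕ → V)
    (hscheme : ∀ n < N, ∀ v : V,
      ⟪τ⁻¹ • (u (n + 1) - u n), v⟫ + a (u n) v = 0)
    (hstab : ∀ v : V, τ * a v v ≤ 2 * ‖v‖ ^ 2) :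
    ∀ n, 1 ≤ n → n ≤ N →
      Real.sqrt (a (u n) (u n)) ≤ Real.sqrt (a (u 0) (u 0)) := by
  intro n _ hn
  apply Real.sqrt_le_sqrt
  clear * - ha_symm hτ hscheme hstab hn
  induction n with
  | zero => exact le_rfl
  | succ k ih =>
    have h := forward_euler_step_energy_le a ha_symm hτ (hscheme k hn _) (hstab _)
    rw [add_sub_cancel] at h
    exact h.trans (ih (Nat.le_of_succ_le hn))
end

section
/- Let ṽ ∈ V be such that there exist μ¹ ∈ W₁ and μ² ∈ W₂ with a(ṽ, v) + s(μ¹, v) + (μ², v) = 0 for all v ∈ V, and s(ṽ, ν) = 0 for all ν ∈ W₁. Assume there exist constants C₁ > 0 and H > 0 such that for every v ∈ W₂ there exists P(v) ∈ V with Π̃(P(v)) = v and ‖P(v)‖_a ≤ C₁ H^{−1} ‖v‖, and assume ‖Π̃(v)‖ ≤ ‖v‖ for all v ∈ V. Then a(ṽ, ṽ) ≤ C₁² H^{−2} ‖ṽ‖², i.e. ‖ṽ‖_a ≤ C₁ H^{−1} ‖ṽ‖. -/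
open scoped RealInnerProductSpace

/-- The key estimate for the second choice of `V_{H,2}`: if `ṽ` satisfies
`a(ṽ, v) + s(μ¹, v) + (μ², v) = 0` for all `v ∈ V` with `μ¹ ∈ W₁`, `μ² ∈ W₂`, and
`s(ṽ, ν) = 0` for all `ν ∈ W₁`, and if every `v ∈ W₂` admits `P(v)` with
`Π̃(P(v)) = v` and `‖P(v)‖_a ≤ C₁H⁻¹‖v‖`, and `‖Π̃(v)‖ ≤ ‖v‖` for all `v`, then
`a(ṽ, ṽ) ≤ C₁²H⁻²‖ṽ‖²`. -/
theorem energy_bound_second_choice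
    {V : Type*} [NormedAddCommGroup V] [InnerProductSpace ℝ V] [FiniteDimensional ℝ V]
    (a s : V →ₗ[ℝ] V →ₗ[ℝ] ℝ)
    (ha_symm : ∀ u v : V, a u v = a v u)
    (ha_posdef : ∀ v : V, v ≠ 0 → 0 < a v v)
    (hs_symm : ∀ u v : V, s u v = s v u)
    (hs_posdef : ∀ v : V, v ≠ 0 → 0 < s v v)
    (W₁ W₂ : Submodule ℝ V)
    (hW_orth : ∀ w₁ ∈ W₁, ∀ w₂ ∈ W₂, s w₁ w₂ = 0)
    -- `Pr` is the `s`-orthogonal projection onto `W₁`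
    (Pr : V → V)
    (hPr_mem : ∀ v : V, Pr v ∈ W₁)
    (hPr : ∀ v : V, ∀ w ∈ W₁, s (Pr v) w = s v w)
    -- `Prt` is the map `Π̃`, with `Π̃(v) = Π(v) + v₂`, `v₂ ∈ W₂`,
    -- `(v₂, w) = (v − Π(v), w)` for all `w ∈ W₂`
    (Prt : V → V)
    (hPrt_mem : ∀ v : V, Prt v - Pr v ∈ W₂)
    (hPrt : ∀ v : V, ∀ w ∈ W₂, ⟪Prt v - Pr v, w⟫ = ⟪v - Pr v, w⟫)
    (C₁ H : ℝ) (hC₁ : 0 < C₁) (hH : 0 < H)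
    (hP : ∀ v ∈ W₂, ∃ Pv : V, Prt Pv = v ∧ Real.sqrt (a Pv Pv) ≤ C₁ * H⁻¹ * ‖v‖)
    (hPrt_bdd : ∀ v : V, ‖Prt v‖ ≤ ‖v‖)
    (vt μ₁ μ₂ : V) (hμ₁ : μ₁ ∈ W₁) (hμ₂ : μ₂ ∈ W₂)
    (heq : ∀ v : V, a vt v + s μ₁ v + ⟪μ₂, v⟫ = 0)
    (hvt : ∀ ν ∈ W₁, s vt ν = 0) :
    a vt vt ≤ C₁ ^ 2 * (H ^ 2)⁻¹ * ‖vt‖ ^ 2 := by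
  have ha_nonneg : ∀ v : V, 0 ≤ a v v := fun v => by
    rcases eq_or_ne v 0 with rfl | hv
    · simp
    · exact (ha_posdef v hv).le
  have le_of_sq_le_mul : ∀ x y : ℝ, 0 ≤ x → 0 ≤ y → x ^ 2 ≤ x * y → x ≤ y := by
    intro x y hx hy h
    rcases hx.eq_or_lt with rfl | hx
    · exact hy
    · exact le_of_mul_le_mul_left (by simpa [sq] using h) hx
  obtain ⟨p, hp, hp_le⟩ := hP μ₂ hμ₂
  have hPr_zero : Pr p = 0 := by
    have hmem : Pr p ∈ W₂ := by
      have h := W₂.sub_mem hμ₂ (hPrt_mem p)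
      rwa [hp, sub_sub_cancel] at h
    by_contra h
    exact (hs_posdef _ h).ne' (hW_orth _ (hPr_mem p) _ hmem)
  have hs_zero : s μ₁ p = 0 := by
    rw [hs_symm, ← hPr p μ₁ hμ₁, hPr_zero]
    simp
  have hinner : ⟪μ₂, p⟫ = ‖μ₂‖ ^ 2 := by
    have h := hPrt p μ₂ hμ₂
    rw [hPr_zero, hp, sub_zero, sub_zero, real_inner_self_eq_norm_sq] at h
    rw [real_inner_comm, h]
  have ha_p : a p p ≤ (C₁ * H⁻¹ * ‖μ₂‖) ^ 2 := (Real.sqrt_le_iff.mp hp_le).2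
  have hcs : a vt p ^ 2 ≤ a vt vt * a p p :=
    LinearMap.BilinForm.apply_sq_le_of_symm a ha_nonneg ⟨fun x y => ha_symm x y⟩ vt p
  have hμ₂_le : ‖μ₂‖ ^ 2 ≤ a vt vt * (C₁ * H⁻¹) ^ 2 := by
    refine le_of_sq_le_mul _ _ (by positivity)
      (mul_nonneg (ha_nonneg vt) (by positivity)) ?_
    have h : a vt p = -‖μ₂‖ ^ 2 := by linarith [heq p]
    calc (‖μ₂‖ ^ 2) ^ 2 = a vt p ^ 2 := by rw [h]; ring
      _ ≤ a vt vt * (C₁ * H⁻¹ * ‖μ₂‖) ^ 2 :=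
        hcs.trans (mul_le_mul_of_nonneg_left ha_p (ha_nonneg vt))
      _ = ‖μ₂‖ ^ 2 * (a vt vt * (C₁ * H⁻¹) ^ 2) := by ring
  refine le_of_sq_le_mul _ _ (ha_nonneg vt) (by positivity) ?_
  have h : a vt vt = -⟪μ₂, vt⟫ := by
    have := heq vt
    rw [hs_symm, hvt μ₁ hμ₁] at this
    linarith
  calc a vt vt ^ 2 = |⟪μ₂, vt⟫| ^ 2 := by rw [h, neg_sq, sq_abs]
    _ ≤ (‖μ₂‖ * ‖vt‖) ^ 2 :=
      pow_le_pow_left₀ (abs_nonneg _) (abs_real_inner_le_norm _ _) 2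
    _ = ‖μ₂‖ ^ 2 * ‖vt‖ ^ 2 := by ring
    _ ≤ a vt vt * (C₁ * H⁻¹) ^ 2 * ‖vt‖ ^ 2 :=
      mul_le_mul_of_nonneg_right hμ₂_le (by positivity)
    _ = a vt vt * (C₁ ^ 2 * (H ^ 2)⁻¹ * ‖vt‖ ^ 2) := by
      rw [mul_pow, inv_pow]; ring
end

section
/- Let f ∈ V, let u ∈ V solve a(u, v) = (f, v) for all v ∈ V, let V₁ be a subspace of V, and let u₁ ∈ V₁ be the Galerkin approximation, i.e. a(u₁, v) = (f, v) for all v ∈ V₁. Let Ṽ := {w ∈ V : a(w, v) = 0 for all v ∈ V₁} be the a-orthogonal complement of V₁. Assume there are constants M ≥ 0 and Λ > 0 such that (f, w) ≤ M‖w‖_s for all w ∈ Ṽ, and ‖w‖_s² ≤ Λ^{−1}‖w‖_a² for all w ∈ Ṽ. Then the energy error satisfies ‖u − u₁‖_a ≤ M Λ^{−1/2}. -/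
open scoped RealInnerProductSpace

/-- Energy error bound for the Galerkin approximation: if `(f, w) ≤ M‖w‖_s` and
`‖w‖_s² ≤ Λ⁻¹‖w‖_a²` on the `a`-orthogonal complement `Ṽ` of `V₁`, then
`‖u − u₁‖_a ≤ M Λ^{−1/2}`. -/
theorem galerkin_energy_error_bound
    {V : Type*} [NormedAddCommGroup V] [InnerProductSpace ℝ V] [FiniteDimensional ℝ V]
    (a s : V →ₗ[ℝ] V →ₗ[ℝ] ℝ)
    (ha_symm : ∀ u v : V, a u v = a v u)
    (ha_posdef : ∀ v : V, v ≠ 0 → 0 < a v v)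
    (hs_symm : ∀ u v : V, s u v = s v u)
    (hs_posdef : ∀ v : V, v ≠ 0 → 0 < s v v)
    (f u : V) (hu : ∀ v : V, a u v = ⟪f, v⟫)
    (V₁ : Submodule ℝ V)
    (u₁ : V) (hu₁_mem : u₁ ∈ V₁) (hu₁ : ∀ v ∈ V₁, a u₁ v = ⟪f, v⟫)
    (M Λ : ℝ) (hM : 0 ≤ M) (hΛ : 0 < Λ)
    (hf : ∀ w : V, (∀ v ∈ V₁, a w v = 0) → ⟪f, w⟫ ≤ M * Real.sqrt (s w w))
    (hspec : ∀ w : V, (∀ v ∈ V₁, a w v = 0) → s w w ≤ Λ⁻¹ * a w w) :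
    Real.sqrt (a (u - u₁) (u - u₁)) ≤ M * (Real.sqrt Λ)⁻¹ := by
  have horth : ∀ v ∈ V₁, a (u - u₁) v = 0 := fun v hv => by
    rw [map_sub, LinearMap.sub_apply, hu, hu₁ v hv, sub_self]
  have henergy : a (u - u₁) (u - u₁) = ⟪f, u - u₁⟫ := by
    rw [← hu, ← sub_eq_zero, ← LinearMap.sub_apply, ← map_sub, sub_sub_cancel_left, map_neg,
      LinearMap.neg_apply, ha_symm, horth u₁ hu₁_mem, neg_zero]
  have hbound := hf _ horth
  have hnorm := Real.sqrt_le_sqrt (hspec _ horth)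
  rw [← henergy] at hbound
  rw [Real.sqrt_mul (inv_nonneg.2 hΛ.le), Real.sqrt_inv] at hnorm
  generalize a (u - u₁) (u - u₁) = E at hbound hnorm ⊢
  rcases le_or_gt E 0 with hE | hE
  · rw [Real.sqrt_eq_zero_of_nonpos hE]
    positivity
  · refine le_of_mul_le_mul_right ?_ (Real.sqrt_pos.2 hE)
    calc √E * √E = E := Real.mul_self_sqrt hE.le
      _ ≤ M * √(s (u - u₁) (u - u₁)) := hbound
      _ ≤ M * ((√Λ)⁻¹ * √E) := mul_le_mul_of_nonneg_left hnorm hM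
      _ = M * (√Λ)⁻¹ * √E := (mul_assoc _ _ _).symm
end

section
/- Let f ∈ V, let u ∈ V solve a(u, v) = (f, v) for all v ∈ V, let V₁ be a subspace of V, and let u₁ ∈ V₁ satisfy a(u₁, v) = (f, v) for all v ∈ V₁. Let K : V → V be a self-adjoint positive-definite linear operator with respect to (·,·), and define ‖v‖_κ := (Kv, v)^{1/2} and ‖g‖_{κ^{−1}} := (K^{−1}g, g)^{1/2}. Suppose there is a constant E ≥ 0 such that for every g ∈ V, the solution z ∈ V of the dual problem a(v, z) = (g, v) for all v ∈ V and its Galerkin approximation z_H ∈ V₁ (a(v, z_H) = (g, v) for all v ∈ V₁) satisfy ‖z − z_H‖_a ≤ E‖g‖_{κ^{−1}}, and also ‖u − u₁‖_a ≤ E‖f‖_{κ^{−1}}. Then the weighted L² error satisfies ‖u − u₁‖_κ ≤ E²‖f‖_{κ^{−1}}. -/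
open scoped RealInnerProductSpace

/-- A positive definite bilinear form on a finite-dimensional real space represents every
linear functional. -/
lemma exists_forall_apply_eq_of_posDef {W : Type*} [AddCommGroup W] [Module ℝ W]
    [FiniteDimensional ℝ W] (b : W →ₗ[ℝ] W →ₗ[ℝ] ℝ) (hb : ∀ w, w ≠ 0 → 0 < b w w)
    (φ : W →ₗ[ℝ] ℝ) : ∃ z, ∀ v, b v z = φ v := by
  have hinj : Function.Injective b.flip := by
    rw [← LinearMap.ker_eq_bot, LinearMap.ker_eq_bot']
    intro w hw
    by_contra hne
    have h : b w w = 0 := by simpa using LinearMap.congr_fun hw w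
    exact (hb w hne).ne' h
  have hdim : Module.finrank ℝ W = Module.finrank ℝ (W →ₗ[ℝ] ℝ) :=
    Subspace.dual_finrank_eq.symm
  obtain ⟨z, hz⟩ := (LinearMap.injective_iff_surjective_of_finrank_eq_finrank hdim).1 hinj φ
  exact ⟨z, fun v => LinearMap.congr_fun hz v⟩

/-- Weighted `L²` error bound via the Aubin–Nitsche duality argument: if the energy
error of the Galerkin method for every dual problem is bounded by `E‖g‖_{κ⁻¹}`, and
`‖u − u₁‖_a ≤ E‖f‖_{κ⁻¹}`, then `‖u − u₁‖_κ ≤ E²‖f‖_{κ⁻¹}`. -/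
theorem weighted_L2_error_bound
    {V : Type*} [NormedAddCommGroup V] [InnerProductSpace ℝ V] [FiniteDimensional ℝ V]
    (a : V →ₗ[ℝ] V →ₗ[ℝ] ℝ)
    (ha_symm : ∀ u v : V, a u v = a v u)
    (ha_posdef : ∀ v : V, v ≠ 0 → 0 < a v v)
    (f u : V) (hu : ∀ v : V, a u v = ⟪f, v⟫)
    (V₁ : Submodule ℝ V)
    (u₁ : V) (hu₁_mem : u₁ ∈ V₁) (hu₁ : ∀ v ∈ V₁, a u₁ v = ⟪f, v⟫)
    -- `K` is a self-adjoint positive definite operator with inverse `Kinv`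
    (K Kinv : V →ₗ[ℝ] V)
    (hK_sa : ∀ x y : V, ⟪K x, y⟫ = ⟪x, K y⟫)
    (hK_pd : ∀ v : V, v ≠ 0 → 0 < ⟪K v, v⟫)
    (hKinv : ∀ v : V, Kinv (K v) = v)
    (hKinv' : ∀ v : V, K (Kinv v) = v)
    (E : ℝ) (hE : 0 ≤ E)
    (hdual : ∀ g z zH : V, (∀ v : V, a v z = ⟪g, v⟫) → zH ∈ V₁ →
      (∀ v ∈ V₁, a v zH = ⟪g, v⟫) →
      Real.sqrt (a (z - zH) (z - zH)) ≤ E * Real.sqrt ⟪Kinv g, g⟫)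
    (hprimal : Real.sqrt (a (u - u₁) (u - u₁)) ≤ E * Real.sqrt ⟪Kinv f, f⟫) :
    Real.sqrt ⟪K (u - u₁), u - u₁⟫ ≤ E ^ 2 * Real.sqrt ⟪Kinv f, f⟫ := by
  have ha_nonneg : ∀ v, 0 ≤ a v v := fun v => by
    rcases eq_or_ne v 0 with rfl | hv
    · simp
    · exact (ha_posdef v hv).le
  set e := u - u₁ with he
  obtain ⟨z, hz⟩ := exists_forall_apply_eq_of_posDef a ha_posdef (innerₗ V (K e))
  obtain ⟨zH, hzH⟩ := exists_forall_apply_eq_of_posDef (a.domRestrict₁₂ V₁ V₁)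
    (fun w hw => ha_posdef w (by simpa using hw)) ((innerₗ V (K e)).domRestrict V₁)
  have hdual_e : √(a (z - zH) (z - zH)) ≤ E * √⟪K e, e⟫ := by
    have h := hdual (K e) z zH hz zH.2 (fun v hv => hzH ⟨v, hv⟩)
    rwa [hKinv, real_inner_comm] at h
  have horth : a e zH = 0 := by
    rw [he, map_sub, LinearMap.sub_apply, hu, hu₁ _ zH.2, sub_self]
  have heq : ⟪K e, e⟫ = a e (z - zH) := by
    rw [map_sub (a e), horth, sub_zero, hz e, innerₗ_apply_apply]
  have hcs : a e (z - zH) ≤ √(a e e) * √(a (z - zH) (z - zH)) := by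
    rw [← Real.sqrt_mul (ha_nonneg e)]
    exact Real.le_sqrt_of_sq_le
      (LinearMap.BilinForm.apply_sq_le_of_symm a ha_nonneg ⟨ha_symm⟩ e (z - zH))
  rcases (Real.sqrt_nonneg ⟪K e, e⟫).eq_or_lt with h0 | hpos
  · rw [← h0]
    positivity
  · refine le_of_mul_le_mul_right ?_ hpos
    calc √⟪K e, e⟫ * √⟪K e, e⟫ = ⟪K e, e⟫ := Real.mul_self_sqrt (Real.sqrt_pos.1 hpos).le
      _ ≤ √(a e e) * √(a (z - zH) (z - zH)) := heq.trans_le hcs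
      _ ≤ (E * √⟪Kinv f, f⟫) * (E * √⟪K e, e⟫) := by gcongr
      _ = E ^ 2 * √⟪Kinv f, f⟫ * √⟪K e, e⟫ := by ring
end

section
/- Let f ∈ V, let u ∈ V solve a(u, v) = (f, v) for all v ∈ V, let W be a subspace of V, and let u_W ∈ W be the Galerkin approximation, i.e. a(u_W, v) = (f, v) for all v ∈ W. Suppose there are constants H > 0 and Γ > 0 such that every w in the a-orthogonal complement of W (i.e. every w ∈ V with a(w, v) = 0 for all v ∈ W) satisfies H^{−2}‖w‖² ≤ Γ^{−1}‖w‖_a². Then ‖u − u_W‖_a ≤ H Γ^{−1/2} ‖f‖. -/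
open scoped RealInnerProductSpace

/-- Energy error bound for the Galerkin approximation on `W` with a Poincaré-type
inequality on the `a`-orthogonal complement: if `H⁻²‖w‖² ≤ Γ⁻¹‖w‖_a²` whenever
`a(w, v) = 0` for all `v ∈ W`, then `‖u − u_W‖_a ≤ H Γ^{−1/2} ‖f‖`. -/
theorem galerkin_energy_error_bound_poincare
    {V : Type*} [NormedAddCommGroup V] [InnerProductSpace ℝ V] [FiniteDimensional ℝ V]
    (a : V →ₗ[ℝ] V →ₗ[ℝ] ℝ)
    (ha_symm : ∀ u v : V, a u v = a v u)
    (ha_posdef : ∀ v : V, v ≠ 0 → 0 < a v v)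
    (f u : V) (hu : ∀ v : V, a u v = ⟪f, v⟫)
    (W : Submodule ℝ V)
    (uW : V) (huW_mem : uW ∈ W) (huW : ∀ v ∈ W, a uW v = ⟪f, v⟫)
    (H Γ : ℝ) (hH : 0 < H) (hΓ : 0 < Γ)
    (hpoincare : ∀ w : V, (∀ v ∈ W, a w v = 0) →
      (H ^ 2)⁻¹ * ‖w‖ ^ 2 ≤ Γ⁻¹ * a w w) :
    Real.sqrt (a (u - uW) (u - uW)) ≤ H * (Real.sqrt Γ)⁻¹ * ‖f‖ := by
  set e := u - uW with he
  have hsub (v : V) : a e v = a u v - a uW v := by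
    rw [he, map_sub, LinearMap.sub_apply]
  have horth : ∀ v ∈ W, a e v = 0 := fun v hv => by
    rw [hsub, hu, huW v hv, sub_self]
  have henergy : a e e = ⟪f, e⟫ := by
    rw [hsub, hu, ha_symm uW e, horth uW huW_mem, sub_zero]
  have hnonneg : 0 ≤ a e e := by
    rcases eq_or_ne e 0 with h | h
    · simp [h]
    · exact (ha_posdef e h).le
  have hsq : √(a e e) ^ 2 = a e e := Real.sq_sqrt hnonneg
  have hnorm : ‖e‖ ≤ H * (√Γ)⁻¹ * √(a e e) := by
    refine (sq_le_sq₀ (norm_nonneg e) (by positivity)).1 ?_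
    have hp := mul_le_mul_of_nonneg_left (hpoincare e horth) (sq_nonneg H)
    rw [mul_inv_cancel_left₀ (by positivity)] at hp
    rw [mul_pow, mul_pow, inv_pow, Real.sq_sqrt hΓ.le, hsq, mul_assoc]
    exact hp
  have hbound : √(a e e) * √(a e e) ≤ H * (√Γ)⁻¹ * ‖f‖ * √(a e e) := by
    calc √(a e e) * √(a e e) = ⟪f, e⟫ := by rw [← sq, hsq, henergy]
      _ ≤ ‖f‖ * ‖e‖ := real_inner_le_norm f e
      _ ≤ ‖f‖ * (H * (√Γ)⁻¹ * √(a e e)) := by gcongr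
      _ = H * (√Γ)⁻¹ * ‖f‖ * √(a e e) := by ring
  rcases (Real.sqrt_nonneg (a e e)).eq_or_lt with h | h
  · rw [← h]
    positivity
  · exact le_of_mul_le_mul_right hbound h
end
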